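/- arXiv:2206.11940 — 2 statements merged into one kernel-verified Lean document; each statement's English description precedes it below -/
import Mathlib

section
/- Assume the environment is proper with horizon D, that rMIN ≤ R(s, a, T(s, a)) ≤ rMAX for all s ∉ Abs and a ∈ A, and that r̄MIN ≤ rMIN. Then for every s ∉ Abs, V*(s) equals the supremum over g ∈ G of V̄*(s, g). -/
open Classical

/-- The state reached after `i` steps when starting in `s` and executing the actions in `as`
(deterministic transition function `T`). `stateAt T s as 0 = s` and
`stateAt T s as (i+1) = T (stateAt T s as i) (as[i])`. -/
def stateAt {S A : Type*} (T : S → A → S) (s : S) (as : List A) (i : ℕ) : S :=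
  (as.take i).foldl T s

/-- `as` is a terminating trajectory from `s`: it is nonempty, the final induced state is
absorbing, and no earlier induced state is absorbing. -/
def Terminating {S A : Type*} (T : S → A → S) (Abs : Set S) (s : S) (as : List A) : Prop :=
  as ≠ [] ∧ stateAt T s as as.length ∈ Abs ∧ ∀ i < as.length, stateAt T s as i ∉ Abs

/-- The achieved goal of a trajectory: the state from which the terminal transition is taken. -/
def achievedGoal {S A : Type*} (T : S → A → S) (s : S) (as : List A) : S :=
  stateAt T s as (as.length - 1)

/-- The return of a trajectory under reward function `R`: the sum of the one-step rewards. -/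
def ret {S A : Type*} (T : S → A → S) (R : S → A → S → ℝ) : S → List A → ℝ
  | _, [] => 0
  | s, a :: as => R s a (T s a) + ret T R (T s a) as

/-- The internal goal set: all states from which some action leads to an absorbing state. -/
def goalSet {S A : Type*} (T : S → A → S) (Abs : Set S) : Set S :=
  {s | ∃ a : A, T s a ∈ Abs}

/-- The goal-oriented reward: a penalty `rbMIN` for terminal transitions taken from a state
other than the goal `g`, and the task reward `R` otherwise. -/
noncomputable def Rbar {S A : Type*} (Abs : Set S) (rbMIN : ℝ) (R : S → A → S → ℝ) (g : S) :
    S → A → S → ℝ :=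
  fun s a s' => if s ≠ g ∧ s' ∈ Abs then rbMIN else R s a s'

/-- The optimal value `Q*(s, a)`: the supremum of returns under `R` over terminating
trajectories from `s` whose first action is `a`. -/
noncomputable def Qstar {S A : Type*} (T : S → A → S) (Abs : Set S) (R : S → A → S → ℝ)
    (s : S) (a : A) : ℝ :=
  sSup {x | ∃ as : List A, Terminating T Abs s as ∧ as.head? = some a ∧ ret T R s as = x}

/-- The optimal state value `V*(s) = sup_a Q*(s, a)`. -/
noncomputable def Vstar {S A : Type*} (T : S → A → S) (Abs : Set S) (R : S → A → S → ℝ)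
    (s : S) : ℝ :=
  sSup (Set.range (Qstar T Abs R s))

/-- The optimal world value `Q̄*(s, g, a)`: the optimal value for the goal-oriented reward. -/
noncomputable def Qbar {S A : Type*} (T : S → A → S) (Abs : Set S) (rbMIN : ℝ)
    (R : S → A → S → ℝ) (s g : S) (a : A) : ℝ :=
  Qstar T Abs (Rbar Abs rbMIN R g) s a

/-- The optimal world state value `V̄*(s, g) = sup_a Q̄*(s, g, a)`. -/
noncomputable def Vbar {S A : Type*} (T : S → A → S) (Abs : Set S) (rbMIN : ℝ)
    (R : S → A → S → ℝ) (s g : S) : ℝ :=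
  sSup (Set.range (Qbar T Abs rbMIN R s g))

/-- The environment is proper with horizon `D`: from every non-absorbing state some
terminating trajectory exists, and every terminating trajectory has length at most `D`. -/
def Proper {S A : Type*} (T : S → A → S) (Abs : Set S) (D : ℕ) : Prop :=
  1 ≤ D ∧ (∀ s ∉ Abs, ∃ as : List A, Terminating T Abs s as) ∧
    ∀ (s : S) (as : List A), Terminating T Abs s as → as.length ≤ D

/-- `g` is reachable from `s`: some terminating trajectory from `s` has achieved goal `g`. -/
def Reachable {S A : Type*} (T : S → A → S) (Abs : Set S) (s g : S) : Prop :=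
  ∃ as : List A, Terminating T Abs s as ∧ achievedGoal T s as = g

/-- The optimal terminal reward at a goal state `g`: the supremum of `R(g, a, T(g, a))`
over actions `a` whose transition from `g` is terminal. -/
noncomputable def Rterm {S A : Type*} (T : S → A → S) (Abs : Set S) (R : S → A → S → ℝ)
    (g : S) : ℝ :=
  sSup {x | ∃ a : A, T g a ∈ Abs ∧ R g a (T g a) = x}

theorem terminating_cons {S A : Type*} {T : S → A → S} {Abs : Set S} {s : S} {a : A}
    {as : List A} : Terminating T Abs s (a :: as) ↔
      s ∉ Abs ∧ ((as = [] ∧ T s a ∈ Abs) ∨ Terminating T Abs (T s a) as) := by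
  have hs : ∀ i, stateAt T s (a :: as) (i + 1) = stateAt T (T s a) as i := by
    intro i; simp [stateAt]
  have h0 : stateAt T s (a :: as) 0 = s := by simp [stateAt]
  constructor
  · rintro ⟨-, h2, h3⟩
    have hn := h3 0 (by simp)
    rw [h0] at hn
    refine ⟨hn, ?_⟩
    rw [List.length_cons, hs] at h2
    by_cases he : as = []
    · subst he
      left
      exact ⟨rfl, by simpa [stateAt] using h2⟩
    · right
      refine ⟨he, h2, fun i hi => ?_⟩
      rw [← hs]
      exact h3 (i + 1) (by simpa using hi)
  · rintro ⟨hn, ⟨rfl, h⟩ | ⟨he, h2, h3⟩⟩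
    · refine ⟨by simp, by simpa [stateAt] using h, fun i hi => ?_⟩
      have : i = 0 := by simpa using hi
      subst this
      rwa [h0]
    · refine ⟨by simp, by rw [List.length_cons, hs]; exact h2, fun i hi => ?_⟩
      cases i with
      | zero => rwa [h0]
      | succ i => rw [hs]; exact h3 i (by simpa using hi)

theorem not_terminating_nil {S A : Type*} {T : S → A → S} {Abs : Set S} {s : S} :
    ¬ Terminating T Abs s ([] : List A) := fun h => h.1 rfl

theorem terminating_start {S A : Type*} {T : S → A → S} {Abs : Set S} {s : S}
    {as : List A} (h : Terminating T Abs s as) : s ∉ Abs := by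
  cases as with
  | nil => exact absurd h not_terminating_nil
  | cons a as => exact (terminating_cons.1 h).1

theorem ret_le_length {S A : Type*} {T : S → A → S} {Abs : Set S} {R : S → A → S → ℝ} {M : ℝ}
    (hM : ∀ s ∉ Abs, ∀ a : A, R s a (T s a) ≤ M) (as : List A) :
    ∀ s, Terminating T Abs s as → ret T R s as ≤ as.length * M := by
  induction as with
  | nil => intro s h; exact absurd h not_terminating_nil
  | cons a as ih =>
    intro s h
    obtain ⟨hn, ⟨rfl, hT⟩ | h⟩ := terminating_cons.1 h
    · simpa [ret] using hM s hn a
    · have := ih _ h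
      have := hM s hn a
      simp only [ret, List.length_cons]
      push_cast
      linarith

theorem ret_Rbar_le {S A : Type*} {T : S → A → S} {Abs : Set S} {R : S → A → S → ℝ} {m : ℝ}
    (hm : ∀ s ∉ Abs, ∀ a : A, m ≤ R s a (T s a)) (g : S) (as : List A) :
    ∀ s, Terminating T Abs s as → ret T (Rbar Abs m R g) s as ≤ ret T R s as := by
  have key : ∀ s ∉ Abs, ∀ a : A, Rbar Abs m R g s a (T s a) ≤ R s a (T s a) := by
    intro s hs a
    unfold Rbar
    split_ifs
    · exact hm s hs a
    · exact le_rfl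
  induction as with
  | nil => intro s h; exact absurd h not_terminating_nil
  | cons a as ih =>
    intro s h
    obtain ⟨hn, ⟨rfl, hT⟩ | h⟩ := terminating_cons.1 h
    · simpa [ret] using key s hn a
    · have := ih _ h
      have := key s hn a
      simp only [ret]
      linarith

theorem exists_goal {S A : Type*} {T : S → A → S} {Abs : Set S} {R : S → A → S → ℝ} {m : ℝ}
    (as : List A) : ∀ s, Terminating T Abs s as →
      ∃ g ∈ goalSet T Abs, ret T (Rbar Abs m R g) s as = ret T R s as := by
  induction as with
  | nil => intro s h; exact absurd h not_terminating_nil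
  | cons a as ih =>
    intro s h
    obtain ⟨hn, ⟨rfl, hT⟩ | h⟩ := terminating_cons.1 h
    · exact ⟨s, ⟨a, hT⟩, by simp [ret, Rbar]⟩
    · obtain ⟨g, hg, he⟩ := ih _ h
      refine ⟨g, hg, ?_⟩
      simp only [ret, he]
      simp [Rbar, terminating_start h]

theorem isLUB_Vstar {S A : Type*} {T : S → A → S} {Abs : Set S} {R : S → A → S → ℝ} {D : ℕ}
    (hP : Proper T Abs D) {s : S} (hs : s ∉ Abs) {B : ℝ}
    (hB : ∀ as, Terminating T Abs s as → ret T R s as ≤ B) :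
    IsLUB {x | ∃ as : List A, Terminating T Abs s as ∧ ret T R s as = x} (Vstar T Abs R s) := by
  have hQ : ∀ a, IsLUB {x | ∃ as : List A, Terminating T Abs s as ∧ as.head? = some a ∧
      ret T R s as = x} (Qstar T Abs R s a) := by
    intro a
    apply isLUB_csSup
    · by_cases h : T s a ∈ Abs
      · exact ⟨_, [a], terminating_cons.2 ⟨hs, Or.inl ⟨rfl, h⟩⟩, rfl, rfl⟩
      · obtain ⟨as, has⟩ := hP.2.1 _ h
        exact ⟨_, a :: as, terminating_cons.2 ⟨hs, Or.inr has⟩, rfl, rfl⟩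
    · refine ⟨B, ?_⟩
      rintro x ⟨as, h, -, rfl⟩
      exact hB as h
  have hV : IsLUB (Set.range (Qstar T Abs R s)) (Vstar T Abs R s) := by
    apply isLUB_csSup
    · obtain ⟨as, has⟩ := hP.2.1 s hs
      cases as with
      | nil => exact absurd has not_terminating_nil
      | cons a as => exact ⟨_, a, rfl⟩
    · refine ⟨B, ?_⟩
      rintro _ ⟨a, rfl⟩
      refine (hQ a).2 ?_
      rintro x ⟨as, h, -, rfl⟩
      exact hB as h
  constructor
  · rintro x ⟨as, h, rfl⟩
    cases as with
    | nil => exact absurd h not_terminating_nil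
    | cons a as => exact ((hQ a).1 ⟨_, h, rfl, rfl⟩).trans (hV.1 ⟨a, rfl⟩)
  · intro u hu
    refine hV.2 ?_
    rintro _ ⟨a, rfl⟩
    refine (hQ a).2 ?_
    rintro x ⟨as, h, -, rfl⟩
    exact hu ⟨as, h, rfl⟩

/-- State-value form of **Theorem 1(ii)**: in a proper environment with bounded rewards and
`r̄MIN ≤ rMIN`, `V*(s) = sup_{g ∈ G} V̄*(s, g)`. -/
theorem vstar_eq_sup_vbar {S A : Type*} (T : S → A → S) (Abs : Set S)
    (R : S → A → S → ℝ) (rMIN rMAX rbMIN : ℝ) (D : ℕ)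
    (hProper : Proper T Abs D)
    (hbound : ∀ s ∉ Abs, ∀ a : A, rMIN ≤ R s a (T s a) ∧ R s a (T s a) ≤ rMAX)
    (hrb : rbMIN ≤ rMIN) :
    ∀ s ∉ Abs,
      Vstar T Abs R s =
        sSup {x | ∃ g ∈ goalSet T Abs, Vbar T Abs rbMIN R s g = x} := by
  intro s hs
  have hm : ∀ s ∉ Abs, ∀ a : A, rbMIN ≤ R s a (T s a) :=
    fun s hs a => hrb.trans (hbound s hs a).1
  have hB : ∀ as, Terminating T Abs s as → ret T R s as ≤ D * |rMAX| := by
    intro as h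
    refine (ret_le_length (M := |rMAX|)
      (fun s hs a => (hbound s hs a).2.trans (le_abs_self _)) as s h).trans ?_
    have : (as.length : ℝ) ≤ D := by exact_mod_cast hProper.2.2 s as h
    gcongr
  have hV := isLUB_Vstar hProper hs hB
  have hVb : ∀ g, IsLUB {x | ∃ as : List A, Terminating T Abs s as ∧
      ret T (Rbar Abs rbMIN R g) s as = x} (Vbar T Abs rbMIN R s g) := fun g =>
    isLUB_Vstar hProper hs (fun as h => (ret_Rbar_le hm g as s h).trans (hB as h))
  symm
  apply IsLUB.csSup_eq
  · constructor
    · rintro _ ⟨g, -, rfl⟩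
      refine (hVb g).2 ?_
      rintro x ⟨as, h, rfl⟩
      exact (ret_Rbar_le hm g as s h).trans (hV.1 ⟨as, h, rfl⟩)
    · intro u hu
      refine hV.2 ?_
      rintro x ⟨as, h, rfl⟩
      obtain ⟨g, hg, he⟩ := exists_goal (R := R) (m := rbMIN) as s h
      rw [← he]
      exact ((hVb g).1 ⟨as, h, rfl⟩).trans (hu ⟨g, hg, rfl⟩)
  · obtain ⟨as, h⟩ := hProper.2.1 s hs
    obtain ⟨g, hg, -⟩ := exists_goal (R := R) (m := rbMIN) as s h
    exact ⟨_, g, hg, rfl⟩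
end

section
/- Assume the mastery hypotheses. Then the optimal world value function has mastery: for every g ∈ S and s ∉ Abs with s ≠ g, if g is reachable from s, then every terminating trajectory from s whose achieved goal is not g has return under R̄(·, g, ·, ·) strictly less than V̄*(s, g); consequently any terminating trajectory from s whose return under R̄(·, g, ·, ·) equals V̄*(s, g) must have achieved goal g. -/
open Classical

theorem term_single {S A : Type*} {T : S → A → S} {Abs : Set S} {s : S} {a : A}
    (h : Terminating T Abs s [a]) : s ∉ Abs ∧ T s a ∈ Abs := by
  obtain ⟨_, h1, h2⟩ := h
  refine ⟨by simpa [stateAt] using h2 0 (by simp), by simpa [stateAt] using h1⟩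

theorem term_cons {S A : Type*} {T : S → A → S} {Abs : Set S} {s : S} {a b : A} {l : List A}
    (h : Terminating T Abs s (a :: b :: l)) :
    s ∉ Abs ∧ T s a ∉ Abs ∧ Terminating T Abs (T s a) (b :: l) := by
  obtain ⟨_, h1, h2⟩ := h
  refine ⟨by simpa [stateAt] using h2 0 (by simp), by simpa [stateAt] using h2 1 (by simp),
    by simp, by simpa [stateAt] using h1, ?_⟩
  intro i hi
  have := h2 (i + 1) (by simpa using hi)
  simpa [stateAt] using this

theorem goal_cons {S A : Type*} (T : S → A → S) (s : S) (a b : A) (l : List A) :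
    achievedGoal T s (a :: b :: l) = achievedGoal T (T s a) (b :: l) := by
  simp [achievedGoal, stateAt]

theorem ret_good {S A : Type*} (T : S → A → S) (Abs : Set S)
    (R : S → A → S → ℝ) (rMIN rMAX rbMIN : ℝ)
    (hbound : ∀ s ∉ Abs, ∀ a : A, rMIN ≤ R s a (T s a) ∧ R s a (T s a) < rMAX) (g : S) :
    ∀ (as : List A) (s : S), Terminating T Abs s as → achievedGoal T s as = g →
      as.length * rMIN ≤ ret T (Rbar Abs rbMIN R g) s as
  | [], s, h, _ => absurd rfl h.1
  | [a], s, h, hg => by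
    have hs := term_single h
    have hg' : s = g := by simpa [achievedGoal, stateAt] using hg
    have := (hbound s hs.1 a).1
    simpa [ret, Rbar, hg'] using hg' ▸ this
  | a :: b :: l, s, h, hg => by
    obtain ⟨h1, h2, h3⟩ := term_cons h
    have ih := ret_good T Abs R rMIN rMAX rbMIN hbound g (b :: l) (T s a) h3
      (by rw [← goal_cons]; exact hg)
    have := (hbound s h1 a).1
    rw [ret, List.length_cons]
    have e : Rbar Abs rbMIN R g s a (T s a) = R s a (T s a) := by simp [Rbar, h2]
    rw [e]
    push_cast
    linarith

theorem ret_bad {S A : Type*} (T : S → A → S) (Abs : Set S)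
    (R : S → A → S → ℝ) (rMIN rMAX rbMIN : ℝ)
    (hbound : ∀ s ∉ Abs, ∀ a : A, rMIN ≤ R s a (T s a) ∧ R s a (T s a) < rMAX) (g : S) :
    ∀ (as : List A) (s : S), Terminating T Abs s as → achievedGoal T s as ≠ g →
      ret T (Rbar Abs rbMIN R g) s as ≤ (as.length - 1) * rMAX + rbMIN
  | [], s, h, _ => absurd rfl h.1
  | [a], s, h, hg => by
    have hs := term_single h
    have hg' : s ≠ g := by simpa [achievedGoal, stateAt] using hg
    simp [ret, Rbar, hg', hs.2]
  | a :: b :: l, s, h, hg => by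
    obtain ⟨h1, h2, h3⟩ := term_cons h
    have ih := ret_bad T Abs R rMIN rMAX rbMIN hbound g (b :: l) (T s a) h3
      (by rw [← goal_cons]; exact hg)
    have := (hbound s h1 a).2
    rw [ret, List.length_cons]
    have e : Rbar Abs rbMIN R g s a (T s a) = R s a (T s a) := by simp [Rbar, h2]
    rw [e]
    push_cast
    linarith

theorem ret_le {S A : Type*} (T : S → A → S) (Abs : Set S)
    (R : S → A → S → ℝ) (rMIN rMAX rbMIN : ℝ)
    (hbound : ∀ s ∉ Abs, ∀ a : A, rMIN ≤ R s a (T s a) ∧ R s a (T s a) < rMAX) (g : S)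
    (hb : rbMIN ≤ rMAX) :
    ∀ (as : List A) (s : S), Terminating T Abs s as →
      ret T (Rbar Abs rbMIN R g) s as ≤ as.length * rMAX
  | [], s, h => absurd rfl h.1
  | [a], s, h => by
    have hs := term_single h
    have := (hbound s hs.1 a).2
    simp only [ret, Rbar, List.length_singleton]
    split_ifs <;> push_cast <;> linarith
  | a :: b :: l, s, h => by
    obtain ⟨h1, h2, h3⟩ := term_cons h
    have ih := ret_le T Abs R rMIN rMAX rbMIN hbound g hb (b :: l) (T s a) h3
    have := (hbound s h1 a).2
    rw [ret, List.length_cons]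
    have e : Rbar Abs rbMIN R g s a (T s a) = R s a (T s a) := by simp [Rbar, h2]
    rw [e]
    push_cast
    linarith

/-- **Theorem 2 (mastery)**: under the mastery hypotheses, for every goal `g` reachable from a
non-absorbing state `s ≠ g`, every terminating trajectory from `s` achieving a goal other than
`g` has `R̄(·, g, ·, ·)`-return strictly below `V̄*(s, g)`; consequently, any terminating
trajectory from `s` whose `R̄(·, g, ·, ·)`-return equals `V̄*(s, g)` achieves `g`. -/
theorem wvf_mastery {S A : Type*} (T : S → A → S) (Abs : Set S)
    (R : S → A → S → ℝ) (rMIN rMAX rbMIN : ℝ) (D : ℕ)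
    (hProper : Proper T Abs D)
    (hbound : ∀ s ∉ Abs, ∀ a : A, rMIN ≤ R s a (T s a) ∧ R s a (T s a) < rMAX)
    (hrMIN : rMIN ≤ 0) (hrMAX : 0 < rMAX)
    (hrb : rbMIN = (rMIN - rMAX) * D) :
    ∀ g : S, ∀ s ∉ Abs, s ≠ g → Reachable T Abs s g →
      (∀ as : List A, Terminating T Abs s as → achievedGoal T s as ≠ g →
        ret T (Rbar Abs rbMIN R g) s as < Vbar T Abs rbMIN R s g) ∧
      (∀ as : List A, Terminating T Abs s as →
        ret T (Rbar Abs rbMIN R g) s as = Vbar T Abs rbMIN R s g →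
        achievedGoal T s as = g) := by
  intro g s hs hsg hreach
  obtain ⟨hD, _, hlen⟩ := hProper
  have hD' : (1 : ℝ) ≤ D := by exact_mod_cast hD
  have hb : rbMIN ≤ rMAX := by rw [hrb]; nlinarith
  have hle : ∀ as : List A, Terminating T Abs s as →
      ret T (Rbar Abs rbMIN R g) s as ≤ D * rMAX := by
    intro as h
    have h1 := ret_le T Abs R rMIN rMAX rbMIN hbound g hb as s h
    have h2 : (as.length : ℝ) ≤ D := by exact_mod_cast hlen s as h
    nlinarith
  have hV : ∀ as : List A, Terminating T Abs s as →
      ret T (Rbar Abs rbMIN R g) s as ≤ Vbar T Abs rbMIN R s g := by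
    intro as h
    obtain ⟨a, l, rfl⟩ := List.exists_cons_of_ne_nil h.1
    refine le_trans (b := Qbar T Abs rbMIN R s g a) ?_ ?_
    · refine le_csSup ⟨D * rMAX, ?_⟩ ⟨a :: l, h, rfl, rfl⟩
      rintro x ⟨as, h, _, rfl⟩
      exact hle as h
    · refine le_csSup ⟨D * rMAX, ?_⟩ ⟨a, rfl⟩
      rintro x ⟨a, rfl⟩
      refine Real.sSup_le ?_ (by positivity)
      rintro x ⟨as, h, _, rfl⟩
      exact hle as h
  have key : ∀ as : List A, Terminating T Abs s as → achievedGoal T s as ≠ g →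
      ret T (Rbar Abs rbMIN R g) s as < Vbar T Abs rbMIN R s g := by
    intro as h hg
    obtain ⟨bs, hbs, hbg⟩ := hreach
    have h1 := ret_bad T Abs R rMIN rMAX rbMIN hbound g as s h hg
    have h2 := ret_good T Abs R rMIN rMAX rbMIN hbound g bs s hbs hbg
    have h3 := hV bs hbs
    have h4 : (as.length : ℝ) ≤ D := by exact_mod_cast hlen s as h
    have h5 : (bs.length : ℝ) ≤ D := by exact_mod_cast hlen s bs hbs
    have h6 : (as.length : ℝ) * rMAX ≤ D * rMAX := mul_le_mul_of_nonneg_right h4 hrMAX.le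
    have h7 : (D : ℝ) * rMIN ≤ bs.length * rMIN := mul_le_mul_of_nonpos_right h5 hrMIN
    rw [hrb] at h1 h2 h3 ⊢
    linarith
  exact ⟨key, fun as h he => by_contra fun hg => (key as h hg).ne he⟩
end
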